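/- Fix an integer k ≥ 2 and an alphabet Σ of k symbols. Let |R̄_n| = 2·Σ_{i=2}^{n} Σ_{r=1}^{⌊i/2⌋} N_{r,i−r} denote the number of ligation and cleavage reactions involving non-oriented polymers of length at most n. Then as n → ∞, |R̄_n| ∼ (1/2)·|R^TUPLE_n| and |R̄_n| ∼ (1/2)·|R^SET_n|; moreover |R̄_n|/|X̄_n| ∼ |R^TUPLE_n|/|X_n| and |R̄_n|/|X̄_n| ∼ |R^SET_n|/|X_n|. -/

import Mathlib

open Filter

/-- T(i): the number of ordered triples (u,v,z) of nonempty words with uv = z, |z| = i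
(the TUPLE convention). -/
noncomputable def T (k i : ℕ) : ℕ :=
  Set.ncard {t : List (Fin k) × List (Fin k) × List (Fin k) |
    t.1 ≠ [] ∧ t.2.1 ≠ [] ∧ t.1 ++ t.2.1 = t.2.2 ∧ t.2.2.length = i}

/-- S(i): the number of such triples counted up to identifying (u,v,z) with (v,u,z)
whenever uv = vu = z (the SET convention). -/
noncomputable def S (k i : ℕ) : ℕ :=
  Set.ncard {s : Finset (List (Fin k)) | ∃ u v : List (Fin k),
    u ≠ [] ∧ v ≠ [] ∧ (u ++ v).length = i ∧ s = {u, v, u ++ v}}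

/-- |R^TUPLE_n| -/
noncomputable def RTUPLE (k n : ℕ) : ℕ := 2 * ∑ i ∈ Finset.Icc 2 n, T k i

/-- |R^SET_n| -/
noncomputable def RSET (k n : ℕ) : ℕ := 2 * ∑ i ∈ Finset.Icc 2 n, S k i

/-- The non-oriented polymer (equivalence class under reversal) of a word w,
represented as the finset {w, w.reverse}. -/
noncomputable def cls {k : ℕ} (w : List (Fin k)) : Finset (List (Fin k)) := {w, w.reverse}

/-- N_{r,s} for r ≠ s: triples (ū, v̄, z̄) of non-oriented polymers of lengths r, s with
z̄ the class of a concatenation of representatives. -/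
noncomputable def Nord (k r s : ℕ) : ℕ :=
  Set.ncard {t : Finset (List (Fin k)) × Finset (List (Fin k)) × Finset (List (Fin k)) |
    ∃ u v : List (Fin k), u.length = r ∧ v.length = s ∧ t.1 = cls u ∧ t.2.1 = cls v ∧
      ∃ u' ∈ cls u, ∃ v' ∈ cls v, t.2.2 = cls (u' ++ v')}

/-- N_{r,r}: the analogous count with the reactant pair {ū, v̄} unordered. -/
noncomputable def Ndiag (k r : ℕ) : ℕ :=
  Set.ncard {t : Sym2 (Finset (List (Fin k))) × Finset (List (Fin k)) |
    ∃ u v : List (Fin k), u.length = r ∧ v.length = r ∧ t.1 = s(cls u, cls v) ∧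
      ∃ u' ∈ cls u, ∃ v' ∈ cls v, t.2 = cls (u' ++ v')}

/-- N_{r,s}: ligation reactions in the non-oriented setting with reactant lengths r, s. -/
noncomputable def Nrs (k r s : ℕ) : ℕ := if r = s then Ndiag k r else Nord k r s

/-- |R̄_n| = 2·Σ_{i=2}^{n} Σ_{r=1}^{⌊i/2⌋} N_{r,i−r}: the number of ligation and cleavage
reactions involving non-oriented polymers of length at most n. -/
noncomputable def Rbar (k n : ℕ) : ℕ :=
  2 * ∑ i ∈ Finset.Icc 2 n, ∑ r ∈ Finset.Icc 1 (i / 2), Nrs k r (i - r)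

/-- |X_n|: the number of words of length between 1 and n. -/
noncomputable def Xcount (k n : ℕ) : ℕ :=
  Set.ncard {w : List (Fin k) | 1 ≤ w.length ∧ w.length ≤ n}

/-- |X̄_n|: the number of non-oriented polymers of length between 1 and n. -/
noncomputable def Xbar (k n : ℕ) : ℕ :=
  Set.ncard {s : Finset (List (Fin k)) |
    ∃ w : List (Fin k), 1 ≤ w.length ∧ w.length ≤ n ∧ s = cls w}

noncomputable def WW (k i : ℕ) : Finset (List (Fin k)) :=
  (List.finite_length_eq (Fin k) i).toFinset

lemma mem_WW {k i : ℕ} {w : List (Fin k)} : w ∈ WW k i ↔ w.length = i := by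
  simp [WW]

lemma card_WW (k i : ℕ) : (WW k i).card = k ^ i := by
  have h : Fintype.card (List.Vector (Fin k) i) = k ^ i := by simp
  rw [← h, ← Nat.card_eq_fintype_card, WW, ← Set.ncard_eq_toFinset_card _ (List.finite_length_eq (Fin k) i)]
  rfl

noncomputable def QQ (k i : ℕ) : Finset (List (Fin k) × List (Fin k)) :=
  (Finset.Icc 1 (i-1)).biUnion (fun r => WW k r ×ˢ WW k (i - r))

lemma mem_QQ {k i : ℕ} {p : List (Fin k) × List (Fin k)} :
    p ∈ QQ k i ↔ p.1 ≠ [] ∧ p.2 ≠ [] ∧ p.1.length + p.2.length = i := by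
  simp only [QQ, Finset.mem_biUnion, Finset.mem_Icc, Finset.mem_product, mem_WW,
    ← List.length_pos_iff]
  constructor
  · rintro ⟨r, h1, h2, h3⟩; omega
  · rintro ⟨h1, h2, h3⟩; exact ⟨p.1.length, by omega, rfl, by omega⟩

lemma card_QQ (k i : ℕ) : (QQ k i).card = (i - 1) * k ^ i := by
  rw [QQ, Finset.card_biUnion]
  · rw [Finset.sum_congr rfl (g := fun _ => k ^ i)]
    · simp
    · intro r hr
      rw [Finset.mem_Icc] at hr
      rw [Finset.card_product, card_WW, card_WW, ← pow_add]
      congr 1; omega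
  · intro r _ r' _ hrr
    refine Finset.disjoint_left.2 ?_
    rintro ⟨u, v⟩ h h'
    simp only [Finset.mem_product, mem_WW] at h h'
    exact hrr (h.1.symm.trans h'.1)

lemma T_eq (k i : ℕ) : T k i = (i - 1) * k ^ i := by
  rw [← card_QQ, T, ← Finset.card_image_of_injective (QQ k i)
    (f := fun p : List (Fin k) × List (Fin k) => (p.1, p.2, p.1 ++ p.2)),
    ← Set.ncard_coe_finset]
  · congr 1
    ext ⟨u, v, z⟩
    simp only [Set.mem_ofPred_eq, Finset.coe_image, Set.mem_image, Finset.mem_coe, mem_QQ,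
      Prod.mk.injEq, Prod.exists]
    constructor
    · rintro ⟨h1, h2, h3, h4⟩
      refine ⟨u, v, ⟨h1, h2, ?_⟩, rfl, rfl, h3⟩
      rw [← h4, ← h3]; simp
    · rintro ⟨a, b, ⟨h1, h2, h3⟩, rfl, rfl, rfl⟩
      exact ⟨h1, h2, rfl, by simpa using h3⟩
  · rintro ⟨a, b⟩ ⟨c, d⟩ h
    simp at h
    simp [h.1, h.2.1]

lemma card_le_of_inj {α β : Type*} [DecidableEq α] [DecidableEq β] (f : α → β) (Q C : Finset α)
    (h : Set.InjOn f (Q \ C : Finset α)) : Q.card ≤ (Q.image f).card + C.card := by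
  have h1 := Finset.card_image_of_injOn h
  have h2 : ((Q \ C).image f).card ≤ (Q.image f).card :=
    Finset.card_le_card (Finset.image_subset_image Finset.sdiff_subset)
  have h3 : Q.card ≤ (Q \ C).card + C.card := by
    have := Finset.le_card_sdiff C Q
    omega
  omega

lemma geomsum_le (k i : ℕ) (hk : 2 ≤ k) : ∑ j ∈ Finset.range i, k ^ j ≤ k ^ i := by
  induction i with
  | zero => simp
  | succ n ih =>
    rw [Finset.sum_range_succ, pow_succ]
    have := Nat.mul_le_mul_left (k ^ n) hk
    omega

noncomputable def WL (k i : ℕ) : Finset (List (Fin k)) := (Finset.range i).biUnion (WW k)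

lemma mem_WL {k i : ℕ} {w : List (Fin k)} : w ∈ WL k i ↔ w.length < i := by
  simp [WL, mem_WW]

lemma card_WL_eq (k i : ℕ) : (WL k i).card = ∑ j ∈ Finset.range i, k ^ j := by
  rw [WL, Finset.card_biUnion]
  · simp [card_WW]
  · intro r _ r' _ hrr
    refine Finset.disjoint_left.2 ?_
    intro u h h'
    rw [mem_WW] at h h'
    exact hrr (h.symm.trans h')

lemma card_WL (k i : ℕ) (hk : 2 ≤ k) : (WL k i).card ≤ k ^ i := by
  rw [card_WL_eq]; exact geomsum_le k i hk

open Classical in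
lemma card_comm (k i : ℕ) (hk : 2 ≤ k) :
    ((QQ k i).filter (fun p => p.1 ++ p.2 = p.2 ++ p.1)).card ≤ 2 * k ^ i := by
  set C := (QQ k i).filter (fun p => p.1 ++ p.2 = p.2 ++ p.1) with hC
  have key : ∀ u u' v : List (Fin k), u.length = u'.length → u.length ≤ v.length →
      u ++ v = v ++ u → u' ++ v = v ++ u' → u = u' := by
    intro u u' v h1 h2 h3 h4
    have e1 := congrArg (List.take u.length) h3
    have e2 := congrArg (List.take u'.length) h4
    rw [List.take_left, List.take_append_of_le_length h2] at e1
    rw [List.take_left, List.take_append_of_le_length (by omega)] at e2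
    rw [e1, e2, h1]
  have h1 : (C.filter (fun p => p.1.length ≤ p.2.length)).card ≤ k ^ i := by
    refine le_trans (Finset.card_le_card_of_injOn Prod.snd ?_ ?_) (card_WL k i hk)
    · rintro ⟨u, v⟩ h
      simp only [hC, Finset.coe_filter, Finset.mem_filter, mem_QQ, Set.mem_ofPred_eq,
        ← List.length_pos_iff] at h
      simp only [Finset.mem_coe, mem_WL]; omega
    · rintro ⟨u, v⟩ h ⟨u', v'⟩ h' hv
      simp only [hC, Finset.coe_filter, Finset.mem_filter, mem_QQ, Set.mem_ofPred_eq] at h h' hv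
      subst hv
      rw [key u u' v (by omega) h.2 h.1.2 h'.1.2]
  have h2 : (C.filter (fun p => ¬ p.1.length ≤ p.2.length)).card ≤ k ^ i := by
    refine le_trans (Finset.card_le_card_of_injOn Prod.fst ?_ ?_) (card_WL k i hk)
    · rintro ⟨u, v⟩ h
      simp only [hC, Finset.coe_filter, Finset.mem_filter, mem_QQ, Set.mem_ofPred_eq,
        ← List.length_pos_iff] at h
      simp only [Finset.mem_coe, mem_WL]; omega
    · rintro ⟨u, v⟩ h ⟨u', v'⟩ h' hv
      simp only [hC, Finset.coe_filter, Finset.mem_filter, mem_QQ, Set.mem_ofPred_eq] at h h' hv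
      subst hv
      rw [key v v' u (by omega) (by omega) h.1.2.symm h'.1.2.symm]
  have := Finset.card_filter_add_card_filter_not (s := C) (fun p => p.1.length ≤ p.2.length)
  omega

lemma S_eq (k i : ℕ) : S k i = ((QQ k i).image (fun p => ({p.1, p.2, p.1 ++ p.2} :
    Finset (List (Fin k))))).card := by
  rw [S, ← Set.ncard_coe_finset]
  congr 1
  ext s
  simp only [Set.mem_ofPred_eq, Finset.coe_image, Set.mem_image, Finset.mem_coe, mem_QQ,
      Prod.exists, List.length_append]
  constructor
  · rintro ⟨u, v, h1, h2, h3, h4⟩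
    exact ⟨u, v, ⟨h1, h2, h3⟩, h4.symm⟩
  · rintro ⟨u, v, ⟨h1, h2, h3⟩, h4⟩
    exact ⟨u, v, h1, h2, h3, h4.symm⟩

lemma S_le (k i : ℕ) : S k i ≤ (i - 1) * k ^ i := by
  rw [S_eq, ← card_QQ]; exact Finset.card_image_le

lemma S_ge (k i : ℕ) (hk : 2 ≤ k) : (i - 1) * k ^ i ≤ S k i + 2 * k ^ i := by
  classical
  rw [S_eq, ← card_QQ]
  refine le_trans (card_le_of_inj _ _ ((QQ k i).filter (fun p => p.1 ++ p.2 = p.2 ++ p.1)) ?_)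
    (Nat.add_le_add_left (card_comm k i hk) _)
  rintro ⟨u, v⟩ h ⟨u', v'⟩ h' e
  simp only [Finset.coe_sdiff, Set.mem_sdiff, Finset.mem_coe, Finset.mem_filter, mem_QQ,
    not_and] at h h'
  obtain ⟨⟨hu, hv, hl⟩, hc⟩ := h
  obtain ⟨⟨hu', hv', hl'⟩, hc'⟩ := h'
  have hc := hc ⟨hu, hv, hl⟩
  have hc' := hc' ⟨hu', hv', hl'⟩
  dsimp only at e
  rw [← List.length_pos_iff] at hu hv hu' hv'
  have a1 : u ++ v ∈ ({u', v', u' ++ v'} : Finset (List (Fin k))) := by rw [← e]; simp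
  have a2 : u ∈ ({u', v', u' ++ v'} : Finset (List (Fin k))) := by rw [← e]; simp
  have a3 : v ∈ ({u', v', u' ++ v'} : Finset (List (Fin k))) := by rw [← e]; simp
  simp only [Finset.mem_insert, Finset.mem_singleton] at a1 a2 a3
  have b1 : u ++ v = u' ++ v' := by
    rcases a1 with a | a | a
    · have := congrArg List.length a; simp at this; omega
    · have := congrArg List.length a; simp at this; omega
    · exact a
  have c2 : u ≠ u' ++ v' := fun a => by
    have := congrArg List.length a; simp at this; omega
  have c3 : v ≠ u' ++ v' := fun a => by
    have := congrArg List.length a; simp at this; omega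
  have fin : u = u' → (u, v) = (u', v') := by
    rintro rfl
    rw [List.append_cancel_left b1]
  rcases a2 with a | a | a
  · exact fin a
  · rcases a3 with b | b | b
    · subst a b; exact absurd b1 hc
    · subst a; subst b
      exact fin ((List.append_cancel_right b1))
    · exact absurd b c3
  · exact absurd a c2

lemma mem_cls {k : ℕ} {w x : List (Fin k)} : x ∈ cls w ↔ x = w ∨ x = w.reverse := by
  simp [cls]

lemma cls_eq_of_mem {k : ℕ} {w x : List (Fin k)} (h : x ∈ cls w) : cls x = cls w := by
  rw [mem_cls] at h
  rcases h with rfl | rfl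
  · rfl
  · simp [cls, Finset.pair_comm]

lemma length_of_mem {k : ℕ} {w x : List (Fin k)} (h : x ∈ cls w) : x.length = w.length := by
  rw [mem_cls] at h
  rcases h with rfl | rfl <;> simp

lemma self_mem_cls {k : ℕ} (w : List (Fin k)) : w ∈ cls w := by simp [cls]

lemma Nord_eq (k r s : ℕ) : Nord k r s = ((WW k r ×ˢ WW k s).image
    (fun p => (cls p.1, cls p.2, cls (p.1 ++ p.2)))).card := by
  rw [Nord, ← Set.ncard_coe_finset]
  congr 1
  ext ⟨a, b, c⟩
  simp only [Set.mem_ofPred_eq, Finset.coe_image, Set.mem_image, Finset.mem_coe,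
    Finset.mem_product, mem_WW, Prod.exists, Prod.mk.injEq]
  constructor
  · rintro ⟨u, v, h1, h2, h3, h4, u', hu, v', hv, h5⟩
    exact ⟨u', v', ⟨by rw [length_of_mem hu, h1], by rw [length_of_mem hv, h2]⟩,
      by rw [cls_eq_of_mem hu, h3], by rw [cls_eq_of_mem hv, h4], h5.symm⟩
  · rintro ⟨u, v, ⟨h1, h2⟩, rfl, rfl, rfl⟩
    exact ⟨u, v, h1, h2, rfl, rfl, u, self_mem_cls u, v, self_mem_cls v, rfl⟩

lemma Nord_le (k r s : ℕ) : Nord k r s ≤ k ^ (r + s) := by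
  rw [Nord_eq]
  refine Finset.card_image_le.trans ?_
  rw [Finset.card_product, card_WW, card_WW, pow_add]

lemma Ndiag_le (k r : ℕ) : Ndiag k r ≤ k ^ (r + r) := by
  have : Ndiag k r ≤ ((WW k r ×ˢ WW k r).image
    (fun p => (s(cls p.1, cls p.2), cls (p.1 ++ p.2)))).card := by
    rw [Ndiag, ← Set.ncard_coe_finset]
    apply Set.ncard_le_ncard _ (Finset.finite_toSet _)
    rintro ⟨a, c⟩
    simp only [Set.mem_ofPred_eq, Finset.coe_image, Set.mem_image, Finset.mem_coe,
      Finset.mem_product, mem_WW, Prod.exists, Prod.mk.injEq]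
    rintro ⟨u, v, h1, h2, h3, u', hu, v', hv, h5⟩
    exact ⟨u', v', ⟨by rw [length_of_mem hu, h1], by rw [length_of_mem hv, h2]⟩,
      by rw [cls_eq_of_mem hu, cls_eq_of_mem hv, h3], h5.symm⟩
  refine this.trans (Finset.card_image_le.trans ?_)
  rw [Finset.card_product, card_WW, pow_add]

lemma Nord_ge (k r s : ℕ) (hrs : r ≤ s) : k ^ (r + s) ≤ Nord k r s + 2 * k ^ s := by
  classical
  have hcard : (WW k r ×ˢ WW k s).card = k ^ (r + s) := by
    rw [Finset.card_product, card_WW, card_WW, pow_add]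
  rw [Nord_eq, ← hcard]
  let B1 := (WW k s).image (fun v => (v.reverse.take r, v))
  let B2 := (WW k s).image (fun v => ((v.reverse.take r).reverse, v))
  have hB : (B1 ∪ B2).card ≤ 2 * k ^ s := by
    have h1 : B1.card ≤ k ^ s := Finset.card_image_le.trans (card_WW k s).le
    have h2 : B2.card ≤ k ^ s := Finset.card_image_le.trans (card_WW k s).le
    have := Finset.card_union_le B1 B2
    omega
  refine le_trans (card_le_of_inj _ _ (B1 ∪ B2) ?_) (Nat.add_le_add_left hB _)
  rintro ⟨u, v⟩ h ⟨u', v'⟩ h' e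
  simp only [Finset.coe_sdiff, Set.mem_sdiff, Finset.mem_coe, Finset.mem_product, mem_WW] at h h'
  simp only [Prod.mk.injEq] at e
  obtain ⟨e1, e2, e3⟩ := e
  have m1 : u' ∈ cls u := by rw [e1]; exact self_mem_cls _
  have m3 : u' ++ v' ∈ cls (u ++ v) := by rw [e3]; exact self_mem_cls _
  rw [mem_cls] at m1 m3
  rcases m3 with m | m
  · have := List.append_inj m (by omega)
    rw [this.1, this.2]
  · exfalso
    apply h.2
    rw [List.reverse_append] at m
    have q := congrArg (List.take r) m
    rw [List.take_append_of_le_length (l₁ := u') (by omega),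
      List.take_of_length_le (l := u') (by omega),
      List.take_append_of_le_length (by rw [List.length_reverse]; omega)] at q
    rw [Finset.mem_union]
    rcases m1 with m1 | m1
    · left
      exact Finset.mem_image.2 ⟨v, mem_WW.2 h.1.2, by rw [← q, m1]⟩
    · right
      exact Finset.mem_image.2 ⟨v, mem_WW.2 h.1.2, by rw [← q, m1]; simp⟩

noncomputable def AA (k i : ℕ) : ℕ := ∑ r ∈ Finset.Icc 1 (i / 2), Nrs k r (i - r)

lemma AA_le (k i : ℕ) : AA k i ≤ (i / 2) * k ^ i := by
  have : AA k i ≤ ∑ r ∈ Finset.Icc 1 (i / 2), k ^ i := by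
    apply Finset.sum_le_sum
    intro r hr
    rw [Finset.mem_Icc] at hr
    have e : r + (i - r) = i := by omega
    unfold Nrs
    split_ifs with h
    · have := Ndiag_le k r
      rwa [show r + r = i by omega] at this
    · have := Nord_le k r (i - r)
      rwa [e] at this
  simpa using this

lemma AA_ge (k i : ℕ) (hk : 2 ≤ k) : (i / 2) * k ^ i ≤ AA k i + 3 * k ^ i := by
  have h1 : ∑ r ∈ Finset.Icc 1 (i / 2), k ^ i ≤ ∑ r ∈ Finset.Icc 1 (i / 2),
      (Nrs k r (i - r) + 2 * k ^ (i - r) + if r = i / 2 then k ^ i else 0) := by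
    apply Finset.sum_le_sum
    intro r hr
    rw [Finset.mem_Icc] at hr
    have e : r + (i - r) = i := by omega
    unfold Nrs
    split_ifs with h h2 h2
    · omega
    · omega
    · omega
    · have := Nord_ge k r (i - r) (by omega)
      rw [e] at this
      omega
  have h2 : ∑ r ∈ Finset.Icc 1 (i / 2), (if r = i / 2 then k ^ i else 0) ≤ k ^ i := by
    rw [Finset.sum_ite_eq']
    split_ifs <;> simp
  have h3 : ∑ r ∈ Finset.Icc 1 (i / 2), k ^ (i - r) ≤ k ^ i := by
    refine le_trans ?_ (geomsum_le k i hk)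
    rw [← Finset.sum_image (s := Finset.Icc 1 (i/2)) (g := fun r => i - r) (f := fun j => k ^ j)]
    · apply Finset.sum_le_sum_of_subset
      intro j hj
      simp only [Finset.mem_image, Finset.mem_Icc, Finset.mem_range] at hj ⊢
      omega
    · intro a ha b hb hab
      simp only [Finset.coe_Icc, Set.mem_Icc] at ha hb hab
      omega
  rw [Finset.sum_add_distrib, Finset.sum_add_distrib, ← Finset.mul_sum] at h1
  simp only [Finset.sum_const, Nat.card_Icc, Nat.add_sub_cancel, smul_eq_mul] at h1
  unfold AA
  omega

lemma Xcount_eq (k n : ℕ) : Xcount k n = ((WL k (n+1)).filter (fun w => 1 ≤ w.length)).card := by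
  rw [Xcount, ← Set.ncard_coe_finset]
  congr 1
  ext w
  simp [mem_WL]; omega

lemma Xbar_eq (k n : ℕ) :
    Xbar k n = (((WL k (n+1)).filter (fun w => 1 ≤ w.length)).image cls).card := by
  rw [Xbar, ← Set.ncard_coe_finset]
  congr 1
  ext s
  simp only [Set.mem_ofPred_eq, Finset.coe_image, Set.mem_image, Finset.mem_coe,
    Finset.mem_filter, mem_WL]
  constructor
  · rintro ⟨w, h1, h2, h3⟩; exact ⟨w, ⟨by omega, h1⟩, h3.symm⟩
  · rintro ⟨w, ⟨h1, h2⟩, h3⟩; exact ⟨w, h2, by omega, h3.symm⟩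

lemma Xcount_le (k n : ℕ) : Xcount k n ≤ 2 * Xbar k n := by
  rw [Xcount_eq, Xbar_eq]
  apply Finset.card_le_mul_card_image
  intro s hs
  obtain ⟨w, hw, rfl⟩ := Finset.mem_image.1 hs
  refine le_trans (Finset.card_le_card (t := cls w) ?_) Finset.card_le_two
  intro x hx
  rw [← (Finset.mem_filter.1 hx).2]
  exact self_mem_cls x

lemma Xcount_ge (k n : ℕ) (hn : 1 ≤ n) : k ^ n ≤ Xcount k n := by
  rw [Xcount_eq, ← card_WW]
  apply Finset.card_le_card
  intro w hw
  rw [mem_WW] at hw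
  simp [mem_WL]; omega

open Classical in
lemma card_pal (k n : ℕ) (hk : 2 ≤ k) :
    ((WL k (n+1)).filter (fun w => w.reverse = w)).card ≤ (n + 1) * k ^ ((n+1)/2 + 1) := by
  calc _ ≤ (Finset.range (n+1) ×ˢ WL k ((n+1)/2+1)).card := by
        apply Finset.card_le_card_of_injOn (fun w => (w.length, w.take ((w.length + 1)/2)))
        · intro w hw
          simp only [Finset.coe_filter, Set.mem_ofPred_eq, mem_WL] at hw
          simp only [Finset.mem_coe, Finset.mem_product, Finset.mem_range, mem_WL,
            List.length_take]
          omega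
        · intro w hw x hx e
          simp only [Finset.coe_filter, Set.mem_ofPred_eq, mem_WL] at hw hx
          simp only [Prod.mk.injEq] at e
          obtain ⟨e1, e2⟩ := e
          rw [← e1] at e2
          have f1 : ∀ j, j < (w.length + 1)/2 → w[j]? = x[j]? := by
            intro j hj
            have := congrArg (fun l => l[j]?) e2
            simpa [List.getElem?_take, hj] using this
          apply List.ext_getElem?
          intro j
          by_cases h1 : j < (w.length + 1)/2
          · exact f1 j h1
          · by_cases h2 : j < w.length
            · rw [← hw.2, ← hx.2, List.getElem?_reverse h2, List.getElem?_reverse (by omega), ← e1]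
              exact f1 _ (by omega)
            · rw [List.getElem?_eq_none (by omega), List.getElem?_eq_none (by omega)]
    _ ≤ _ := by
        rw [Finset.card_product, Finset.card_range]
        exact Nat.mul_le_mul_left _ (card_WL k _ hk)

lemma Xbar_le (k n : ℕ) (hk : 2 ≤ k) :
    2 * Xbar k n ≤ Xcount k n + 2 * ((n + 1) * k ^ ((n+1)/2 + 1)) := by
  classical
  rw [Xcount_eq, Xbar_eq]
  set W := (WL k (n+1)).filter (fun w => 1 ≤ w.length) with hW
  have hs := Finset.filter_union_filter_not_eq (fun w : List (Fin k) => w.reverse = w) W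
  have h1 : (W.filter (fun w => w.reverse = w)).card ≤ (n + 1) * k ^ ((n+1)/2 + 1) :=
    le_trans (Finset.card_le_card (Finset.filter_subset_filter _ (Finset.filter_subset _ _)))
      (card_pal k n hk)
  have h2 : 2 * ((W.filter (fun w => ¬ w.reverse = w)).image cls).card
      ≤ (W.filter (fun w => ¬ w.reverse = w)).card := by
    apply Finset.mul_card_image_le_card
    intro s hs
    obtain ⟨w, hw, rfl⟩ := Finset.mem_image.1 hs
    have hw2 := (Finset.mem_filter.1 hw).2
    have : (cls w).card = 2 := by
      rw [cls, Finset.card_pair (fun h => hw2 h.symm)]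
    rw [← this]
    apply Finset.card_le_card
    intro x hx
    have hl := length_of_mem hx
    have hc := cls_eq_of_mem hx
    rw [Finset.mem_filter]
    refine ⟨?_, hc⟩
    simp only [hW, Finset.mem_filter, mem_WL] at hw ⊢
    refine ⟨by omega, ?_⟩
    rw [mem_cls] at hx
    rcases hx with rfl | rfl
    · exact hw2
    · rw [List.reverse_reverse]; exact fun h => hw2 h.symm
  have h3 : (W.image cls).card ≤ ((W.filter (fun w => w.reverse = w)).image cls).card +
      ((W.filter (fun w => ¬ w.reverse = w)).image cls).card := by
    conv_lhs => rw [← hs]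
    rw [Finset.image_union]
    exact Finset.card_union_le _ _
  have h4 : ((W.filter (fun w => w.reverse = w)).image cls).card ≤
    (W.filter (fun w => w.reverse = w)).card := Finset.card_image_le
  have h5 : (W.filter (fun w => ¬ w.reverse = w)).card ≤ W.card :=
    Finset.card_le_card (Finset.filter_subset _ _)
  omega

lemma Xbar_tendsto (k : ℕ) (hk : 2 ≤ k) :
    Tendsto (fun n => (2 * (Xbar k n : ℝ)) / (Xcount k n : ℝ)) atTop (nhds 1) := by
  have hk' : (2:ℝ) ≤ k := by exact_mod_cast hk
  have hm : Tendsto (fun m : ℕ => 1 + (2 * k * (2 * ((m:ℝ) ^ 1 * (1/(k:ℝ)) ^ m) +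
      2 * (((m:ℝ)^0 * (1/(k:ℝ)) ^ m))))) atTop (nhds 1) := by
    have hr : |(1/(k:ℝ))| < 1 := by
      rw [abs_of_pos (by positivity), div_lt_one (by positivity)]; linarith
    have a := tendsto_pow_const_mul_const_pow_of_abs_lt_one 1 hr
    have b := tendsto_pow_const_mul_const_pow_of_abs_lt_one 0 hr
    have := (((a.const_mul 2).add (b.const_mul 2)).const_mul (2 * (k:ℝ))).const_add 1
    simpa using this
  have hh := hm.comp (Nat.tendsto_div_const_atTop (n := 2) (by norm_num))
  refine tendsto_of_tendsto_of_tendsto_of_le_of_le' tendsto_const_nhds hh ?_ ?_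
  · filter_upwards [eventually_ge_atTop 1] with n hn
    have h0 : (0:ℝ) < Xcount k n := by
      have := Xcount_ge k n hn
      have : 0 < k ^ n := by positivity
      exact_mod_cast (by omega : 0 < Xcount k n)
    rw [le_div_iff₀ h0, one_mul]
    exact_mod_cast Xcount_le k n
  · filter_upwards [eventually_ge_atTop 1] with n hn
    have h1 : (k:ℝ)^n ≤ Xcount k n := by exact_mod_cast Xcount_ge k n hn
    have h2 : 2 * (Xbar k n : ℝ) ≤ Xcount k n + 2 * ((n + 1) * (k:ℝ) ^ ((n+1)/2 + 1)) := by
      exact_mod_cast Xbar_le k n hk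
    have hkn : (0:ℝ) < (k:ℝ)^n := by positivity
    have h0 : (0:ℝ) < Xcount k n := lt_of_lt_of_le hkn h1
    simp only [Function.comp]
    set m := n / 2 with hmdef
    have hn2 : (n:ℝ) + 1 ≤ 2 * m + 2 := by
      have : n + 1 ≤ 2 * m + 2 := by omega
      exact_mod_cast this
    have hp : (k:ℝ) ^ ((n+1)/2 + 1) * (k:ℝ)^m = k * k ^ n := by
      rw [← pow_add, ← pow_succ']
      congr 1; omega
    have hp' : (k:ℝ) ^ ((n+1)/2 + 1) = k * k ^ n * (1/(k:ℝ))^m := by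
      rw [← hp, mul_assoc, ← mul_pow, mul_one_div_cancel (by positivity), one_pow, mul_one]
    rw [div_le_iff₀ h0, add_mul, one_mul]
    refine h2.trans (add_le_add_right ?_ _)
    calc 2 * (((n:ℝ) + 1) * (k:ℝ) ^ ((n+1)/2 + 1))
        ≤ 2 * ((2 * m + 2) * (k:ℝ) ^ ((n+1)/2 + 1)) := by gcongr
      _ = (2 * k * (2 * ((m:ℝ) ^ 1 * (1/(k:ℝ)) ^ m) +
      2 * (((m:ℝ)^0 * (1/(k:ℝ)) ^ m)))) * k ^ n := by rw [hp']; ring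
      _ ≤ _ := by gcongr

lemma ratio_tendsto (k : ℕ) (hk : 2 ≤ k) (f : ℕ → ℝ) (C : ℝ)
    (hf : ∀ i, 2 ≤ i → |f i - ((i - 1 : ℕ) : ℝ) * (k:ℝ)^i| ≤ C * (k:ℝ)^i) :
    Tendsto (fun n => (∑ i ∈ Finset.Icc 2 n, f i) / (∑ i ∈ Finset.Icc 2 n, (T k i : ℝ)))
      atTop (nhds 1) := by
  have hk' : (2:ℝ) ≤ k := by exact_mod_cast hk
  have hT : ∀ i, (T k i : ℝ) = ((i - 1 : ℕ) : ℝ) * (k:ℝ)^i := by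
    intro i; rw [T_eq]; push_cast; rfl
  let h : ℕ → ℝ := fun i => if 2 ≤ i then f i - (T k i : ℝ) else 0
  have hC : 0 ≤ C := by
    have := (abs_nonneg _).trans (hf 2 le_rfl)
    by_contra hc
    have : C * (k:ℝ)^2 < 0 := mul_neg_of_neg_of_pos (by linarith) (by positivity)
    linarith
  have ho : h =o[atTop] (fun i => (T k i : ℝ)) := by
    rw [Asymptotics.isLittleO_iff]
    intro c hc
    obtain ⟨M, hM⟩ := exists_nat_gt (C / c)
    filter_upwards [eventually_ge_atTop (M + 2)] with i hi
    have hi2 : 2 ≤ i := by omega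
    simp only [h, hi2, if_true]
    rw [hT, Real.norm_eq_abs, Real.norm_eq_abs]
    refine (hf i hi2).trans ?_
    rw [abs_of_nonneg (by positivity), ← mul_assoc]
    gcongr
    have : (M:ℝ) ≤ ((i-1:ℕ):ℝ) := by exact_mod_cast (by omega : M ≤ i - 1)
    rw [div_lt_iff₀ hc] at hM
    nlinarith
  have hsum : Tendsto (fun n => ∑ i ∈ Finset.range n, (T k i : ℝ)) atTop atTop := by
    refine tendsto_atTop_mono' atTop (f₁ := fun n : ℕ => ((n:ℝ) - 2)) ?_ ?_
    · filter_upwards [eventually_ge_atTop 3] with n hn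
      obtain ⟨m, rfl⟩ : ∃ m, n = m + 1 := ⟨n - 1, by omega⟩
      have : (T k m : ℝ) ≤ ∑ i ∈ Finset.range (m+1), (T k i : ℝ) :=
        Finset.single_le_sum (f := fun i => (T k i : ℝ)) (fun i _ => by positivity) (by simp)
      refine le_trans ?_ this
      rw [hT, Nat.cast_sub (by omega)]
      have h1 : (1:ℝ) ≤ (k:ℝ)^m := one_le_pow₀ (by linarith)
      have h2 : (2:ℝ) ≤ m := by exact_mod_cast (by omega : 2 ≤ m)
      push_cast
      nlinarith
    · exact tendsto_atTop_add_const_right _ (-2) tendsto_natCast_atTop_atTop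
  have hso := (ho.sum_range (fun i => by positivity) hsum)
  have hlim := hso.tendsto_div_nhds_zero.comp (tendsto_add_atTop_nat 1)
  have hpos := (hsum.comp (tendsto_add_atTop_nat 1)).eventually_gt_atTop 0
  have h1 := hlim.const_add 1
  rw [add_zero] at h1
  refine h1.congr' ?_
  filter_upwards [hpos] with n hn
  simp only [Function.comp] at hn ⊢
  have split : ∀ g : ℕ → ℝ, (∀ i, i < 2 → g i = 0) →
      ∑ i ∈ Finset.Icc 2 n, g i = ∑ i ∈ Finset.range (n+1), g i := by
    intro g hg
    apply Finset.sum_subset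
    · intro i hi
      simp only [Finset.mem_Icc, Finset.mem_range] at hi ⊢; omega
    · intro i hi hi'
      simp only [Finset.mem_Icc, Finset.mem_range] at hi hi'
      exact hg i (by omega)
  have s1 := split (fun i => (T k i : ℝ)) (fun i hi => by
    rw [hT, show i - 1 = 0 by omega]; simp)
  have s2 := split h (fun i hi => by simp only [h]; rw [if_neg (by omega)])
  have s3 : ∑ i ∈ Finset.Icc 2 n, f i = ∑ i ∈ Finset.Icc 2 n, (T k i : ℝ) +
      ∑ i ∈ Finset.Icc 2 n, h i := by
    rw [← Finset.sum_add_distrib]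
    apply Finset.sum_congr rfl
    intro i hi
    rw [Finset.mem_Icc] at hi
    simp only [h, hi.1, if_true]; ring
  rw [s3, s1, s2]
  field_simp

lemma Rbar_tendsto (k : ℕ) (hk : 2 ≤ k) :
    Tendsto (fun n => (2 * (Rbar k n : ℝ)) / (RTUPLE k n : ℝ)) atTop (nhds 1) := by
  refine (ratio_tendsto k hk (fun i => 2 * (AA k i : ℝ)) 7 ?_).congr ?_
  · intro i hi
    have h1 := AA_le k i
    have h2 := AA_ge k i hk
    have h3 : 2 * (i / 2 * k ^ i) ≤ (i - 1) * k ^ i + k ^ i := by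
      rw [← mul_assoc, ← Nat.succ_mul]
      exact Nat.mul_le_mul_right _ (by omega)
    have h4 : (i - 1) * k ^ i ≤ 2 * (i / 2 * k ^ i) := by
      rw [← mul_assoc]
      exact Nat.mul_le_mul_right _ (by omega)
    have u1 : 2 * AA k i ≤ (i - 1) * k ^ i + 7 * k ^ i := by omega
    have u2 : (i - 1) * k ^ i ≤ 2 * AA k i + 7 * k ^ i := by omega
    have v1 : 2 * (AA k i : ℝ) ≤ ((i - 1 : ℕ) : ℝ) * (k:ℝ) ^ i + 7 * (k:ℝ) ^ i := by
      exact_mod_cast u1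
    have v2 : ((i - 1 : ℕ) : ℝ) * (k:ℝ) ^ i ≤ 2 * (AA k i : ℝ) + 7 * (k:ℝ) ^ i := by
      exact_mod_cast u2
    rw [abs_le]; constructor <;> linarith
  · intro n
    have : Rbar k n = 2 * ∑ i ∈ Finset.Icc 2 n, AA k i := rfl
    rw [this, RTUPLE, ← Finset.mul_sum]
    push_cast
    rw [mul_div_mul_left _ _ (two_ne_zero)]

lemma RSET_tendsto (k : ℕ) (hk : 2 ≤ k) :
    Tendsto (fun n => (RSET k n : ℝ) / (RTUPLE k n : ℝ)) atTop (nhds 1) := by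
  refine (ratio_tendsto k hk (fun i => (S k i : ℝ)) 2 ?_).congr ?_
  · intro i hi
    have v1 : (S k i : ℝ) ≤ ((i - 1 : ℕ) : ℝ) * (k:ℝ) ^ i := by
      exact_mod_cast S_le k i
    have v2 : ((i - 1 : ℕ) : ℝ) * (k:ℝ) ^ i ≤ (S k i : ℝ) + 2 * (k:ℝ) ^ i := by
      exact_mod_cast S_ge k i hk
    have : (0:ℝ) ≤ (k:ℝ)^i := by positivity
    rw [abs_le]; constructor <;> linarith
  · intro n
    rw [RSET, RTUPLE]
    push_cast
    rw [mul_div_mul_left _ _ (two_ne_zero)]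

lemma ev_ne {f : ℕ → ℝ} {g : ℕ → ℝ} (h : Tendsto (fun n => f n / g n) atTop (nhds 1)) :
    ∀ᶠ n in atTop, f n ≠ 0 ∧ g n ≠ 0 := by
  filter_upwards [h.eventually_ne one_ne_zero] with n hn
  constructor
  · intro h0; simp [h0] at hn
  · intro h0; simp [h0] at hn

/-- |R̄_n| ∼ (1/2)|R^TUPLE_n|, |R̄_n| ∼ (1/2)|R^SET_n|,
|R̄_n|/|X̄_n| ∼ |R^TUPLE_n|/|X_n| and |R̄_n|/|X̄_n| ∼ |R^SET_n|/|X_n| as n → ∞. -/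
theorem stmt_19 (k : ℕ) (hk : 2 ≤ k) :
    Tendsto (fun n : ℕ => (Rbar k n : ℝ) / ((1 / 2) * (RTUPLE k n : ℝ)))
      atTop (nhds 1) ∧
    Tendsto (fun n : ℕ => (Rbar k n : ℝ) / ((1 / 2) * (RSET k n : ℝ)))
      atTop (nhds 1) ∧
    Tendsto (fun n : ℕ =>
        ((Rbar k n : ℝ) / (Xbar k n : ℝ)) / ((RTUPLE k n : ℝ) / (Xcount k n : ℝ)))
      atTop (nhds 1) ∧
    Tendsto (fun n : ℕ =>
        ((Rbar k n : ℝ) / (Xbar k n : ℝ)) / ((RSET k n : ℝ) / (Xcount k n : ℝ)))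
      atTop (nhds 1) := by
  have a := Rbar_tendsto k hk
  have b := RSET_tendsto k hk
  have c := Xbar_tendsto k hk
  have ab := a.div b one_ne_zero
  have ac := a.div c one_ne_zero
  have abc := ab.div c one_ne_zero
  simp only [div_one] at ab ac abc
  refine ⟨a.congr ?_, ab.congr' ?_, ac.congr' ?_, abc.congr' ?_⟩
  · intro n
    ring
  · filter_upwards [ev_ne a, ev_ne b] with n ha hb
    simp only [Pi.div_apply]
    have := ha.2
    have := hb.1
    field_simp
  · filter_upwards [ev_ne a, ev_ne c] with n ha hc
    simp only [Pi.div_apply]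
    have := ha.2
    have := hc.2
    have := right_ne_zero_of_mul hc.1
    field_simp
  · filter_upwards [ev_ne a, ev_ne b, ev_ne c] with n ha hb hc
    simp only [Pi.div_apply]
    have := ha.2
    have := hb.1
    have := hc.2
    have := right_ne_zero_of_mul hc.1
    field_simp
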